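/- There exists a function C₁ of one real variable such that: for every F ∈ C²(T⁵) satisfying the normalization (N) ∫_{[0,1]⁵}(e^F − 1) dx = 0, and every φ ∈ C⁴(T⁵) with ∫_{[−1/2,1/2]⁵} φ = 0 solving equation (★), one has ‖Δφ‖_{C⁰} ≤ C₁(‖F‖_{C²}) · (1 + ‖φ‖_{C¹}), where Δφ = φ_{11}+φ_{22}+φ_{33}+φ_{44}+φ_{55}. -/

import Mathlib

open MeasureTheory

/-- Partial derivative in the `i`-th coordinate direction. -/
noncomputable def pd {n : ℕ} (i : Fin n) (f : (Fin n → ℝ) → ℝ) : (Fin n → ℝ) → ℝ :=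
  fun x => fderiv ℝ f x (Pi.single i 1)

/-- Second partial derivative `∂²f/∂x^i∂x^j`. -/
noncomputable def pd2 {n : ℕ} (i j : Fin n) (f : (Fin n → ℝ) → ℝ) : (Fin n → ℝ) → ℝ :=
  pd i (pd j f)

/-- A function on `ℝⁿ` that is `1`-periodic in every coordinate, i.e. a function on `Tⁿ`. -/
def PeriodicPi {n : ℕ} (f : (Fin n → ℝ) → ℝ) : Prop :=
  ∀ x : Fin n → ℝ, ∀ i : Fin n, f (x + Pi.single i 1) = f x

/-- The Euclidean Laplacian. -/
noncomputable def lap {n : ℕ} (f : (Fin n → ℝ) → ℝ) : (Fin n → ℝ) → ℝ :=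
  fun x => ∑ i, pd2 i i f x

/-- Equation (★): the reduction of the quaternionic Monge–Ampère equation to `T⁵`. -/
def EqStar (F φ : (Fin 5 → ℝ) → ℝ) : Prop :=
  ∀ x : Fin 5 → ℝ,
    (pd2 0 0 φ x + pd2 1 1 φ x + pd2 2 2 φ x + pd2 3 3 φ x + 1) * (pd2 4 4 φ x + 1)
      - (pd2 0 4 φ x) ^ 2 - (pd2 1 4 φ x) ^ 2 - (pd2 2 4 φ x) ^ 2 - (pd2 3 4 φ x) ^ 2
      = Real.exp (F x)

/-- Iterated partial derivative `∂^I f` for a multi-index `I`. -/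
noncomputable def pdI {n : ℕ} (I : Fin n → ℕ) (f : (Fin n → ℝ) → ℝ) : (Fin n → ℝ) → ℝ :=
  (List.finRange n).foldr (fun i g => (pd i)^[I i] g) f

/-- The `Cᵏ`-norm `max_{|I| ≤ k} sup_x |∂^I f(x)|`. -/
noncomputable def CNorm {n : ℕ} (k : ℕ) (f : (Fin n → ℝ) → ℝ) : ℝ :=
  ⨆ I : Fin n → ℕ, ⨆ _ : (∑ i, I i) ≤ k, ⨆ x : Fin n → ℝ, |pdI I f x|

section PartialDerivatives

variable {n : ℕ} {f g : (Fin n → ℝ) → ℝ}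

theorem pd_contDiff {m k : ℕ} (h : ContDiff ℝ k f) (hmk : m + 1 ≤ k) (i : Fin n) :
    ContDiff ℝ m (pd i f) :=
  (h.fderiv_right (by exact_mod_cast hmk)).clm_apply contDiff_const

theorem pd2_contDiff {m k : ℕ} (h : ContDiff ℝ k f) (hmk : m + 2 ≤ k) (i j : Fin n) :
    ContDiff ℝ m (pd2 i j f) :=
  pd_contDiff (pd_contDiff (m := m + 1) h hmk j) le_rfl i

theorem pd_add (hf : Differentiable ℝ f) (hg : Differentiable ℝ g) (i : Fin n) :
    pd i (f + g) = pd i f + pd i g := by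
  funext x
  simp [pd, fderiv_add (hf x) (hg x)]

theorem pd_sub (hf : Differentiable ℝ f) (hg : Differentiable ℝ g) (i : Fin n) :
    pd i (f - g) = pd i f - pd i g := by
  funext x
  simp [pd, fderiv_sub (hf x) (hg x)]

theorem pd_mul (hf : Differentiable ℝ f) (hg : Differentiable ℝ g) (i : Fin n) :
    pd i (f * g) = pd i f * g + f * pd i g := by
  funext x
  simp [pd, fderiv_mul (hf x) (hg x)]
  ring

theorem pd_const (c : ℝ) (i : Fin n) : pd i (fun _ => c) = 0 := by
  funext x
  simp [pd]

theorem pd_exp (hf : Differentiable ℝ f) (i : Fin n) :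
    pd i (fun x => Real.exp (f x)) = (fun x => Real.exp (f x)) * pd i f := by
  funext x
  simp [pd, fderiv_exp (hf x)]

theorem pd2_add (hf : ContDiff ℝ 2 f) (hg : ContDiff ℝ 2 g) (i j : Fin n) :
    pd2 i j (f + g) = pd2 i j f + pd2 i j g := by
  have hf' := (pd_contDiff (m := 1) (k := 2) hf le_rfl j).differentiable (by simp)
  have hg' := (pd_contDiff (m := 1) (k := 2) hg le_rfl j).differentiable (by simp)
  rw [pd2, pd_add (hf.differentiable (by simp)) (hg.differentiable (by simp)), pd_add hf' hg']
  rfl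

theorem pd2_sub (hf : ContDiff ℝ 2 f) (hg : ContDiff ℝ 2 g) (i j : Fin n) :
    pd2 i j (f - g) = pd2 i j f - pd2 i j g := by
  have hf' := (pd_contDiff (m := 1) (k := 2) hf le_rfl j).differentiable (by simp)
  have hg' := (pd_contDiff (m := 1) (k := 2) hg le_rfl j).differentiable (by simp)
  rw [pd2, pd_sub (hf.differentiable (by simp)) (hg.differentiable (by simp)), pd_sub hf' hg']
  rfl

theorem pd2_mul_self (hf : ContDiff ℝ 2 f) (hg : ContDiff ℝ 2 g) (i : Fin n) :
    pd2 i i (f * g) = pd2 i i f * g + 2 * pd i f * pd i g + f * pd2 i i g := by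
  have df := hf.differentiable (by simp)
  have dg := hg.differentiable (by simp)
  have hf' := (pd_contDiff (m := 1) (k := 2) hf le_rfl i).differentiable (by simp)
  have hg' := (pd_contDiff (m := 1) (k := 2) hg le_rfl i).differentiable (by simp)
  rw [pd2, pd_mul df dg, pd_add (hf'.mul dg) (df.mul hg'), pd_mul hf' dg, pd_mul df hg']
  simp only [pd2]
  ring

theorem pd2_exp_self (hf : ContDiff ℝ 2 f) (i : Fin n) :
    pd2 i i (fun x => Real.exp (f x)) =
      (fun x => Real.exp (f x)) * (pd2 i i f + pd i f ^ 2) := by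
  have df := hf.differentiable (by simp)
  have hf' := (pd_contDiff (m := 1) (k := 2) hf le_rfl i).differentiable (by simp)
  rw [pd2, pd_exp df, pd_mul df.exp hf', pd_exp df]
  simp only [pd2]
  ring

theorem pd2_const (c : ℝ) (i j : Fin n) : pd2 i j (fun _ => c) = 0 := by
  rw [pd2, pd_const]
  exact pd_const 0 i

theorem pd_sum {ι : Type*} {h : ι → (Fin n → ℝ) → ℝ} (s : Finset ι)
    (hh : ∀ k ∈ s, Differentiable ℝ (h k)) (i : Fin n) :
    pd i (∑ k ∈ s, h k) = ∑ k ∈ s, pd i (h k) := by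
  funext x
  simp only [pd, fderiv_sum fun k hk => hh k hk x, _root_.sum_apply,
    Finset.sum_apply]

theorem pd2_sum {ι : Type*} {h : ι → (Fin n → ℝ) → ℝ} (s : Finset ι)
    (hh : ∀ k ∈ s, ContDiff ℝ 2 (h k)) (i j : Fin n) :
    pd2 i j (∑ k ∈ s, h k) = ∑ k ∈ s, pd2 i j (h k) := by
  rw [pd2, pd_sum s fun k hk => (hh k hk).differentiable (by simp),
    pd_sum s fun k hk =>
      (pd_contDiff (m := 1) (k := 2) (hh k hk) le_rfl j).differentiable (by simp)]
  rfl

theorem contDiff_two_sum {ι : Type*} {h : ι → (Fin n → ℝ) → ℝ} (s : Finset ι)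
    (hh : ∀ k ∈ s, ContDiff ℝ 2 (h k)) : ContDiff ℝ 2 (∑ k ∈ s, h k) := by
  convert ContDiff.sum hh using 1
  funext x
  simp

theorem pd2_add_const (c : ℝ) (i j : Fin n) : pd2 i j (fun x => f x + c) = pd2 i j f := by
  have h : pd j (fun x => f x + c) = pd j f := by
    funext x
    simp [pd]
  rw [pd2, h, pd2]

theorem pd_comm (hf : ContDiff ℝ 2 f) (i j : Fin n) : pd i (pd j f) = pd j (pd i f) := by
  have key : ∀ (k l : Fin n) x, pd k (pd l f) x =
      fderiv ℝ (fderiv ℝ f) x (Pi.single k 1) (Pi.single l 1) := by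
    intro k l x
    have hd : DifferentiableAt ℝ (fderiv ℝ f) x :=
      (hf.fderiv_right (m := 1) (by norm_num)).differentiable (by simp) x
    change fderiv ℝ (fun y => fderiv ℝ f y (Pi.single l 1)) x (Pi.single k 1) = _
    rw [fderiv_clm_apply hd (differentiableAt_const _)]
    simp
  funext x
  rw [key, key]
  exact (hf.contDiffAt.isSymmSndFDerivAt (by simp)) _ _

theorem pd2_comm (hf : ContDiff ℝ 4 f) (i j k l : Fin n) :
    pd2 i j (pd2 k l f) = pd2 k l (pd2 i j f) := by
  have h1 : ∀ a, ContDiff ℝ 3 (pd a f) := fun a => pd_contDiff (m := 3) (k := 4) hf le_rfl a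
  have h2 : ∀ a b, ContDiff ℝ 2 (pd a (pd b f)) :=
    fun a b => pd_contDiff (m := 2) (k := 3) (h1 b) le_rfl a
  have h12 : ∀ a, ContDiff ℝ 2 (pd a f) := fun a => (h1 a).of_le (by norm_num)
  have hf2 : ContDiff ℝ 2 f := hf.of_le (by norm_num)
  simp only [pd2]
  rw [pd_comm (h12 l) j k, pd_comm hf2 j l, pd_comm (h2 l j) i k, pd_comm (h12 j) i l]

theorem pd2_lap (hf : ContDiff ℝ 4 f) (i j : Fin n) :
    pd2 i j (lap f) = ∑ k, pd2 k k (pd2 i j f) := by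
  have h2 : ∀ k, ContDiff ℝ 2 (pd2 k k f) := fun k => pd2_contDiff (m := 2) (k := 4) hf le_rfl k k
  have hlap : lap f = ∑ k, pd2 k k f := by
    funext x
    simp [lap]
  rw [hlap, pd2_sum _ fun k _ => h2 k]
  exact Finset.sum_congr rfl fun k _ => pd2_comm hf _ _ _ _

theorem lap_contDiff (hf : ContDiff ℝ 4 f) : ContDiff ℝ 2 (lap f) :=
  ContDiff.sum fun k _ => pd2_contDiff (m := 2) (k := 4) hf le_rfl k k

end PartialDerivatives

section Maximum

theorem deriv_deriv_nonpos_of_isMax {g : ℝ → ℝ} (hg : Continuous g) {t : ℝ}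
    (hmax : ∀ s, g s ≤ g t) : deriv (deriv g) t ≤ 0 := by
  by_contra! hpos
  have hlm : IsLocalMax g t := Filter.Eventually.of_forall hmax
  have hmin := isLocalMin_of_deriv_deriv_pos hpos hlm.deriv_eq_zero hg.continuousAt
  have hconst : g =ᶠ[nhds t] fun _ => g t := by
    filter_upwards [hmin] with s hs
    exact le_antisymm (hmax s) hs
  have := hconst.deriv.deriv_eq
  simp at this
  linarith

variable {n : ℕ} {f : (Fin n → ℝ) → ℝ}

theorem fderiv_fderiv_nonpos_of_isMax (hf : ContDiff ℝ 2 f) {x : Fin n → ℝ}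
    (hmax : ∀ y, f y ≤ f x) (v : Fin n → ℝ) :
    fderiv ℝ (fun y => fderiv ℝ f y v) x v ≤ 0 := by
  have line : ∀ t : ℝ, HasDerivAt (fun s : ℝ => x + s • v) v t := fun t => by
    simpa using ((hasDerivAt_id t).smul_const v).const_add x
  have comp : ∀ {h : (Fin n → ℝ) → ℝ}, Differentiable ℝ h →
      deriv (fun s : ℝ => h (x + s • v)) = fun s => fderiv ℝ h (x + s • v) v := by
    intro h hh
    funext t
    exact ((hh _).hasFDerivAt.comp_hasDerivAt t (line t)).deriv
  have hd : Differentiable ℝ (fun y => fderiv ℝ f y v) :=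
    ((hf.fderiv_right (m := 1) (by norm_num)).clm_apply contDiff_const).differentiable (by simp)
  have h := deriv_deriv_nonpos_of_isMax (g := fun s : ℝ => f (x + s • v)) (t := 0)
    (hf.continuous.comp (by fun_prop)) (by simpa using fun s => hmax (x + s • v))
  rw [comp (hf.differentiable (by simp)), comp hd] at h
  simpa using h

theorem pd2_quadratic_nonpos_of_isMax (hf : ContDiff ℝ 2 f) {x : Fin n → ℝ}
    (hmax : ∀ y, f y ≤ f x) (i j : Fin n) (s t : ℝ) :
    s ^ 2 * pd2 i i f x + 2 * s * t * pd2 i j f x + t ^ 2 * pd2 j j f x ≤ 0 := by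
  have h := fderiv_fderiv_nonpos_of_isMax hf hmax
    (s • Pi.single i (1 : ℝ) + t • Pi.single j (1 : ℝ))
  have hd : ∀ k, Differentiable ℝ (pd k f) :=
    fun k => (pd_contDiff (m := 1) (k := 2) hf le_rfl k).differentiable (by simp)
  have hfirst : (fun y => fderiv ℝ f y (s • Pi.single i (1 : ℝ) + t • Pi.single j (1 : ℝ))) =
      fun y => s * pd i f y + t * pd j f y := by
    funext y
    simp [pd]
  rw [hfirst, fderiv_fun_add ((hd i x).const_mul s) ((hd j x).const_mul t),
    fderiv_const_mul (hd i x), fderiv_const_mul (hd j x)] at h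
  simp only [map_add, map_smul, _root_.add_apply, _root_.smul_apply, smul_eq_mul] at h
  have hcomm : pd j (pd i f) x = pd i (pd j f) x := by rw [pd_comm hf]
  simp only [pd2]
  simp only [pd] at h hcomm ⊢
  rw [hcomm] at h
  linarith

end Maximum

section Periodic

variable {n : ℕ} {f : (Fin n → ℝ) → ℝ}

theorem PeriodicPi.exists_mem_Icc (hf : PeriodicPi f) (x : Fin n → ℝ) :
    ∃ y ∈ Set.Icc (0 : Fin n → ℝ) 1, f y = f x := by
  let P : AddSubgroup (Fin n → ℝ) :=
    { carrier := {v | ∀ x, f (x + v) = f x}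
      zero_mem' := fun x => by simp
      add_mem' := fun {a b} ha hb x => by rw [← add_assoc, hb, ha]
      neg_mem' := fun {a} ha x => by simpa using (ha (x + -a)).symm }
  have hsingle : ∀ i, Pi.single i (1 : ℝ) ∈ P := fun i x => hf x i
  have hP : (∑ i, (-⌊x i⌋) • Pi.single i (1 : ℝ)) ∈ P :=
    P.sum_mem fun i _ => P.zsmul_mem (hsingle i) _
  have hcoord : ∀ j, (x + ∑ i, (-⌊x i⌋) • Pi.single i (1 : ℝ)) j = Int.fract (x j) := by
    intro j
    simp [Finset.sum_apply, Pi.single_apply, Int.fract, sub_eq_add_neg]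
  refine ⟨_, ⟨fun j => ?_, fun j => ?_⟩, hP x⟩
  · rw [hcoord]
    exact Int.fract_nonneg _
  · rw [hcoord]
    exact (Int.fract_lt_one _).le

theorem PeriodicPi.exists_isMax (hf : PeriodicPi f) (hc : Continuous f) :
    ∃ x, ∀ y, f y ≤ f x := by
  obtain ⟨x, -, hx⟩ := isCompact_Icc.exists_isMaxOn
    (Set.nonempty_Icc.2 (zero_le_one (α := Fin n → ℝ))) hc.continuousOn
  refine ⟨x, fun y => ?_⟩
  obtain ⟨z, hz, hzy⟩ := hf.exists_mem_Icc y
  exact hzy ▸ hx hz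

theorem PeriodicPi.pd (hf : PeriodicPi f) (i : Fin n) : PeriodicPi (pd i f) := by
  intro x j
  have h : (fun y => f (y + Pi.single j 1)) = f := funext fun y => hf y j
  simp only [_root_.pd]
  rw [← fderiv_comp_add_right, h]

theorem PeriodicPi.lap (hf : PeriodicPi f) : PeriodicPi (lap f) := fun x i =>
  Finset.sum_congr rfl fun k _ => ((hf.pd k).pd k) x i

theorem abs_pdI_le_CNorm {k : ℕ} {I : Fin n → ℕ} (hI : ∑ i, I i ≤ k)
    (hper : PeriodicPi (pdI I f)) (hc : Continuous (pdI I f)) (x : Fin n → ℝ) :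
    |pdI I f x| ≤ CNorm k f := by
  have hx : |pdI I f x| ≤ ⨆ y, |pdI I f y| := by
    obtain ⟨m, hm⟩ := PeriodicPi.exists_isMax (f := fun y => |pdI I f y|)
      (fun y i => congrArg abs (hper y i)) hc.abs
    exact le_ciSup (f := fun y => |pdI I f y|) ⟨_, Set.forall_mem_range.2 hm⟩ x
  have hfin : {J : Fin n → ℕ | ∑ i, J i ≤ k}.Finite :=
    (Set.finite_Iic (fun _ : Fin n => k)).subset fun J hJ i =>
      (Finset.single_le_sum (fun j _ => Nat.zero_le (J j)) (Finset.mem_univ i)).trans hJ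
  have hbdd : BddAbove (Set.range fun J : Fin n → ℕ =>
      ⨆ _ : ∑ i, J i ≤ k, ⨆ y, |pdI J f y|) := by
    refine ((hfin.image fun J => ⨆ _ : ∑ i, J i ≤ k, ⨆ y, |pdI J f y|).insert 0).bddAbove.mono ?_
    rintro _ ⟨J, rfl⟩
    by_cases hJ : ∑ i, J i ≤ k
    · exact Or.inr ⟨J, hJ, rfl⟩
    · left
      simp [hJ]
  refine hx.trans ?_
  have := le_ciSup hbdd I
  simp only [hI, ciSup_unique] at this
  exact this

theorem pdI_zero (f : (Fin n → ℝ) → ℝ) : pdI 0 f = f := by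
  simp [pdI]

theorem CNorm_zero_le {c : ℝ} (hc : 0 ≤ c) (h : ∀ x, |f x| ≤ c) : CNorm 0 f ≤ c := by
  refine ciSup_le fun I => Real.iSup_le (fun hI => ciSup_le fun x => ?_) hc
  have hI0 : I = 0 := by
    funext i
    simpa using (Finset.single_le_sum (fun j _ => Nat.zero_le (I j)) (Finset.mem_univ i)).trans hI
  rw [hI0, pdI_zero]
  exact h x

theorem pdI_single_two (f : (Fin 5 → ℝ) → ℝ) (k : Fin 5) :
    pdI (Pi.single k 2) f = pd2 k k f := by
  fin_cases k <;> simp [pdI, pd2, List.finRange_succ, Pi.single_apply]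

end Periodic

/-- Reverse Cauchy–Schwarz inequality for the Lorentzian form `A B - |b|²`. -/
theorem lorentz_reverse_cauchy_schwarz {ι : Type*} (s : Finset ι) {A B a c : ℝ} {b d : ι → ℝ}
    (hB : 0 < B) (hq : 0 ≤ A * B - ∑ i ∈ s, b i ^ 2) :
    4 * (A * B - ∑ i ∈ s, b i ^ 2) * (a * c - ∑ i ∈ s, d i ^ 2) ≤
      (a * B + A * c - 2 * ∑ i ∈ s, b i * d i) ^ 2 := by
  have hsum : ∑ i ∈ s, (B * d i - c * b i) ^ 2 =
      B ^ 2 * ∑ i ∈ s, d i ^ 2 - 2 * B * c * ∑ i ∈ s, b i * d i + c ^ 2 * ∑ i ∈ s, b i ^ 2 := by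
    rw [Finset.mul_sum, Finset.mul_sum, Finset.mul_sum, ← Finset.sum_sub_distrib,
      ← Finset.sum_add_distrib]
    exact Finset.sum_congr rfl fun i _ => by ring
  have hnonneg : 0 ≤ ∑ i ∈ s, (B * d i - c * b i) ^ 2 := Finset.sum_nonneg fun i _ => sq_nonneg _
  rw [hsum] at hnonneg
  refine le_of_mul_le_mul_left ?_ (pow_pos hB 2)
  nlinarith [mul_nonneg hq hnonneg,
    sq_nonneg (B * (a * B - 2 * ∑ i ∈ s, b i * d i - A * c) + 2 * c * ∑ i ∈ s, b i ^ 2)]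

/-- Concavity of `log (A B - |b|²)`, as a bound for the twice differentiated equation
`A B - |b|² = e^F`. -/
theorem exp_mul_pd2_le {n : ℕ} {ι : Type*} [Fintype ι] {A B F : (Fin n → ℝ) → ℝ}
    {b : ι → (Fin n → ℝ) → ℝ} (hA : ContDiff ℝ 2 A) (hB : ContDiff ℝ 2 B) (hF : ContDiff ℝ 2 F)
    (hb : ∀ i, ContDiff ℝ 2 (b i)) (heq : ∀ x, A x * B x - ∑ i, b i x ^ 2 = Real.exp (F x))
    (k : Fin n) {x : Fin n → ℝ} (hpos : 0 < B x) :
    Real.exp (F x) * pd2 k k F x ≤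
      pd2 k k A x * B x + A x * pd2 k k B x - 2 * ∑ i, b i x * pd2 k k (b i) x := by
  have heq' : A * B - ∑ i, b i * b i = fun x => Real.exp (F x) := by
    funext y
    simp [← heq y, sq]
  have hbb : ∀ i ∈ Finset.univ, ContDiff ℝ 2 (b i * b i) := fun i _ => (hb i).mul (hb i)
  have hsum := contDiff_two_sum Finset.univ hbb
  have hAB : ContDiff ℝ 2 (A * B) := hA.mul hB
  have h1 := congrFun (congrArg (pd k) heq') x
  rw [pd_sub (hAB.differentiable (by simp)) (hsum.differentiable (by simp)),
    pd_mul (hA.differentiable (by simp)) (hB.differentiable (by simp)),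
    pd_sum _ fun i hi => (hbb i hi).differentiable (by simp), pd_exp (hF.differentiable (by simp)),
    Finset.sum_congr rfl fun i _ =>
      pd_mul ((hb i).differentiable (by simp)) ((hb i).differentiable (by simp)) k] at h1
  have h2 := congrFun (congrArg (pd2 k k) heq') x
  rw [pd2_sub hAB hsum, pd2_mul_self hA hB, pd2_sum _ hbb, pd2_exp_self hF,
    Finset.sum_congr rfl fun i _ => pd2_mul_self (hb i) (hb i) k] at h2
  simp only [Pi.sub_apply, Pi.add_apply, Pi.mul_apply, Pi.pow_apply, Finset.sum_apply,
    Pi.ofNat_apply] at h1 h2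
  have e1 : ∑ i, (pd k (b i) x * b i x + b i x * pd k (b i) x) =
      2 * ∑ i, b i x * pd k (b i) x := by
    rw [Finset.mul_sum]
    exact Finset.sum_congr rfl fun i _ => by ring
  have e2 : ∑ i, (pd2 k k (b i) x * b i x + 2 * pd k (b i) x * pd k (b i) x +
      b i x * pd2 k k (b i) x) =
      2 * ∑ i, b i x * pd2 k k (b i) x + 2 * ∑ i, pd k (b i) x ^ 2 := by
    rw [Finset.mul_sum, Finset.mul_sum, ← Finset.sum_add_distrib]
    exact Finset.sum_congr rfl fun i _ => by ring
  rw [e1] at h1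
  rw [e2] at h2
  have hexp := Real.exp_pos (F x)
  have hcs := lorentz_reverse_cauchy_schwarz Finset.univ (A := A x) (b := fun i => b i x)
    (a := pd k A x) (c := pd k B x) (d := fun i => pd k (b i) x) hpos
    (by rw [heq]; exact hexp.le)
  have h1' : pd k A x * B x + A x * pd k B x - 2 * ∑ i, b i x * pd k (b i) x =
    Real.exp (F x) * pd k F x := h1
  rw [heq, h1', mul_pow, sq (Real.exp (F x)), mul_assoc, mul_assoc, mul_left_comm] at hcs
  have hcs' := le_of_mul_le_mul_left hcs hexp
  nlinarith [mul_nonneg hexp.le (sq_nonneg (pd k F x))]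

theorem EqStar.exp_eq {F φ : (Fin 5 → ℝ) → ℝ} (h : EqStar F φ) (x : Fin 5 → ℝ) :
    ((∑ i : Fin 4, pd2 i.castSucc i.castSucc φ) x + 1) * (pd2 4 4 φ x + 1) -
      ∑ i : Fin 4, pd2 i.castSucc 4 φ x ^ 2 = Real.exp (F x) := by
  rw [← h x]
  simp [Fin.sum_univ_four]
  ring

theorem EqStar.pd2_last_add_one_pos {F φ : (Fin 5 → ℝ) → ℝ} (h : EqStar F φ)
    (hφ : ContDiff ℝ 2 φ) (hper : PeriodicPi φ) (x : Fin 5 → ℝ) : 0 < pd2 4 4 φ x + 1 := by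
  by_contra! hx
  have h0 : ContDiff ℝ 2 (fun _ : Fin 5 → ℝ => (0 : ℝ)) := contDiff_const
  have hsub : ContDiff ℝ 2 ((fun _ => 0) - φ) := h0.sub hφ
  obtain ⟨m, hm⟩ := PeriodicPi.exists_isMax (f := (fun _ => 0) - φ)
    (fun y i => congrArg (fun r => 0 - r) (hper y i)) hsub.continuous
  have hm2 := pd2_quadratic_nonpos_of_isMax hsub hm 4 4 0 1
  rw [pd2_sub h0 hφ, pd2_const] at hm2
  simp at hm2
  have hc : Continuous fun y => pd2 4 4 φ y + 1 :=
    (pd2_contDiff (m := 0) (k := 2) hφ le_rfl 4 4).continuous.add continuous_const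
  obtain ⟨z, hz⟩ := mem_range_of_exists_le_of_exists_ge hc ⟨x, hx⟩
    ⟨m, (by linarith : (0 : ℝ) ≤ pd2 4 4 φ m + 1)⟩
  have hz' := h z
  simp only at hz
  rw [hz] at hz'
  nlinarith [Real.exp_pos (F z), sq_nonneg (pd2 0 4 φ z), sq_nonneg (pd2 1 4 φ z),
    sq_nonneg (pd2 2 4 φ z), sq_nonneg (pd2 3 4 φ z)]

/-- The linearized operator at `φ`, applied to `Δφ`, is bounded below by `e^F ΔF`. -/
theorem EqStar.exp_mul_lap_le {F φ : (Fin 5 → ℝ) → ℝ} (h : EqStar F φ) (hF : ContDiff ℝ 2 F)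
    (hφ : ContDiff ℝ 4 φ) (hper : PeriodicPi φ) (x : Fin 5 → ℝ) :
    Real.exp (F x) * lap F x ≤
      (∑ i : Fin 4, pd2 i.castSucc i.castSucc (lap φ) x) * (pd2 4 4 φ x + 1)
      + ((∑ i : Fin 4, pd2 i.castSucc i.castSucc φ x) + 1) * pd2 4 4 (lap φ) x
      - 2 * ∑ i : Fin 4, pd2 i.castSucc 4 φ x * pd2 i.castSucc 4 (lap φ) x := by
  have h2 : ∀ i j, ContDiff ℝ 2 (pd2 i j φ) := fun i j =>
    pd2_contDiff (m := 2) (k := 4) hφ le_rfl i j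
  have hsum := contDiff_two_sum Finset.univ
    fun (i : Fin 4) (_ : i ∈ Finset.univ) => h2 i.castSucc i.castSucc
  have key := fun k => exp_mul_pd2_le (hsum.add contDiff_const) ((h2 4 4).add contDiff_const) hF
    (fun i => h2 (Fin.castSucc i) 4) h.exp_eq k (x := x)
    (h.pd2_last_add_one_pos (hφ.of_le (by norm_num)) hper x)
  simp only [pd2_add_const,
    pd2_sum _ fun (i : Fin 4) (_ : i ∈ Finset.univ) => h2 i.castSucc i.castSucc] at key
  have hle := Finset.sum_le_sum fun k (_ : k ∈ Finset.univ) => key k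
  have hcomm : ∑ k, ∑ i : Fin 4, pd2 i.castSucc 4 φ x * pd2 k k (pd2 i.castSucc 4 φ) x =
      ∑ i : Fin 4, ∑ k, pd2 i.castSucc 4 φ x * pd2 k k (pd2 i.castSucc 4 φ) x := Finset.sum_comm
  have hcomm' : ∑ k, ∑ i : Fin 4, pd2 k k (pd2 i.castSucc i.castSucc φ) x =
      ∑ i : Fin 4, ∑ k, pd2 k k (pd2 i.castSucc i.castSucc φ) x := Finset.sum_comm
  simp only [Finset.sum_apply, Finset.sum_sub_distrib, Finset.sum_add_distrib, ← Finset.mul_sum,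
    ← Finset.sum_mul] at hle
  rw [hcomm, hcomm'] at hle
  simpa only [pd2_lap hφ, Finset.sum_apply, ← Finset.mul_sum, lap] using hle

/-- Upper bound for the Laplacian at a maximum point of `Δφ - φ`. -/
theorem EqStar.lap_add_two_le_of_isMax {F φ : (Fin 5 → ℝ) → ℝ} (h : EqStar F φ)
    (hF : ContDiff ℝ 2 F) (hφ : ContDiff ℝ 4 φ) (hper : PeriodicPi φ) {x : Fin 5 → ℝ}
    (hmax : ∀ y, (lap φ - φ) y ≤ (lap φ - φ) x) :
    lap φ x + 2 ≤ Real.exp (F x) * (2 - lap F x) := by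
  have hφ2 : ContDiff ℝ 2 φ := hφ.of_le (by norm_num)
  have hlap := lap_contDiff hφ
  have hB := h.pd2_last_add_one_pos hφ2 hper x
  have hq := h.exp_eq x
  have hL := h.exp_mul_lap_le hF hφ hper x
  have hdiff : ContDiff ℝ 2 (lap φ - φ) := hlap.sub hφ2
  have hH := fun i => pd2_quadratic_nonpos_of_isMax hdiff hmax (Fin.castSucc i) (4 : Fin 5)
    (pd2 4 4 φ x + 1) (-pd2 (Fin.castSucc i) 4 φ x)
  have hlast := pd2_quadratic_nonpos_of_isMax hdiff hmax (4 : Fin 5) 4 0 1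
  have hsub : ∀ i j, pd2 i j (lap φ - φ) x = pd2 i j (lap φ) x - pd2 i j φ x := fun i j => by
    rw [pd2_sub hlap hφ2]
    rfl
  have hlapx : lap φ x = (∑ i : Fin 4, pd2 i.castSucc i.castSucc φ x) + pd2 4 4 φ x := by
    rw [lap, Fin.sum_univ_castSucc]
    rfl
  rw [hlapx]
  simp only [hsub, Finset.sum_apply] at hH hlast hq
  have hexp := Real.exp_pos (F x)
  have hlast' : pd2 4 4 (lap φ) x - pd2 4 4 φ x ≤ 0 := by linarith
  have hneg := mul_nonpos_of_nonneg_of_nonpos hexp.le hlast'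
  have h0 := hH 0
  have h1 := hH 1
  have h2 := hH 2
  have h3 := hH 3
  simp only [Fin.sum_univ_four] at hq hL ⊢
  suffices hfin : (pd2 4 4 φ x + 1) * (Real.exp (F x) * lap F x - 2 * Real.exp (F x) +
      (pd2 (Fin.castSucc 0) (Fin.castSucc 0) φ x + pd2 (Fin.castSucc 1) (Fin.castSucc 1) φ x +
      pd2 (Fin.castSucc 2) (Fin.castSucc 2) φ x + pd2 (Fin.castSucc 3) (Fin.castSucc 3) φ x +
      pd2 4 4 φ x + 2)) ≤ 0 by
    linarith [nonpos_of_mul_nonpos_right hfin hB]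
  have hBL := mul_le_mul_of_nonneg_left hL hB.le
  rw [← hq] at hneg hBL ⊢
  linarith

theorem EqStar.neg_two_le_lap {F φ : (Fin 5 → ℝ) → ℝ} (h : EqStar F φ)
    (hφ : ContDiff ℝ 2 φ) (hper : PeriodicPi φ) (x : Fin 5 → ℝ) : -2 ≤ lap φ x := by
  have hB := h.pd2_last_add_one_pos hφ hper x
  have hx := h x
  have hA : 0 < pd2 0 0 φ x + pd2 1 1 φ x + pd2 2 2 φ x + pd2 3 3 φ x + 1 := by
    refine pos_of_mul_pos_left ?_ hB.le
    nlinarith [Real.exp_pos (F x), sq_nonneg (pd2 0 4 φ x), sq_nonneg (pd2 1 4 φ x),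
      sq_nonneg (pd2 2 4 φ x), sq_nonneg (pd2 3 4 φ x)]
  rw [lap, Fin.sum_univ_five]
  linarith

theorem abs_le_CNorm {n k : ℕ} {f : (Fin n → ℝ) → ℝ} (hper : PeriodicPi f) (hc : Continuous f)
    (x : Fin n → ℝ) : |f x| ≤ CNorm k f := by
  have := abs_pdI_le_CNorm (k := k) (I := 0) (f := f) (by simp) (by rwa [pdI_zero])
    (by rwa [pdI_zero]) x
  rwa [pdI_zero] at this

theorem abs_lap_le_CNorm {f : (Fin 5 → ℝ) → ℝ} (hper : PeriodicPi f) (hf : ContDiff ℝ 2 f)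
    (x : Fin 5 → ℝ) : |lap f x| ≤ 5 * CNorm 2 f := by
  have hk : ∀ k, |pd2 k k f x| ≤ CNorm 2 f := fun k => by
    have := abs_pdI_le_CNorm (k := 2) (I := Pi.single k 2) (f := f) (by simp)
      (by rw [pdI_single_two]; exact (hper.pd k).pd k)
      (by rw [pdI_single_two]; exact (pd2_contDiff (m := 0) (k := 2) hf le_rfl k k).continuous) x
    rwa [pdI_single_two] at this
  calc |lap f x| ≤ ∑ k, |pd2 k k f x| := Finset.abs_sum_le_sum_abs _ _
    _ ≤ ∑ _k : Fin 5, CNorm 2 f := Finset.sum_le_sum fun k _ => hk k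
    _ = 5 * CNorm 2 f := by simp

/-- A priori estimate `‖Δφ‖_{C⁰} ≤ C₁(‖F‖_{C²})(1 + ‖φ‖_{C¹})` for solutions of the
quaternionic Monge–Ampère equation on `T⁵`. -/
theorem laplacian_C1_estimate :
    ∃ C₁ : ℝ → ℝ,
      ∀ F φ : (Fin 5 → ℝ) → ℝ,
        ContDiff ℝ 2 F → PeriodicPi F →
        (∫ x in Set.Icc (0 : Fin 5 → ℝ) 1, (Real.exp (F x) - 1) = 0) →
        ContDiff ℝ 4 φ → PeriodicPi φ →
        (∫ x in Set.Icc ((fun _ => -(1/2)) : Fin 5 → ℝ) (fun _ => 1/2), φ x) = 0 →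
        EqStar F φ →
        CNorm 0 (lap φ) ≤ C₁ (CNorm 2 F) * (1 + CNorm 1 φ) := by
  refine ⟨fun t => Real.exp t * (2 + 5 * t) + 2, ?_⟩
  intro F φ hF hFper _ hφ hφper _ h
  have hφ2 : ContDiff ℝ 2 φ := hφ.of_le (by norm_num)
  have hN := fun x => abs_le_CNorm (k := 2) hFper hF.continuous x
  have hM := fun x => abs_le_CNorm (k := 1) hφper hφ.continuous x
  have hN0 : 0 ≤ CNorm 2 F := (abs_nonneg _).trans (hN 0)
  have hM0 : 0 ≤ CNorm 1 φ := (abs_nonneg _).trans (hM 0)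
  have hE : 0 ≤ Real.exp (CNorm 2 F) * (2 + 5 * CNorm 2 F) := by positivity
  have hEM := mul_nonneg hE hM0
  refine CNorm_zero_le (by positivity) fun x => abs_le.2 ⟨?_, ?_⟩
  · nlinarith [h.neg_two_le_lap hφ2 hφper x]
  obtain ⟨m, hm⟩ := PeriodicPi.exists_isMax (f := lap φ - φ)
    (fun y i => congrArg₂ (fun a b => a - b) (hφper.lap y i) (hφper y i))
    ((lap_contDiff hφ).continuous.sub hφ.continuous)
  have hupper := h.lap_add_two_le_of_isMax hF hφ hφper hm
  have hbound : Real.exp (F m) * (2 - lap F m) ≤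
      Real.exp (CNorm 2 F) * (2 + 5 * CNorm 2 F) := by
    have h1 := Real.exp_le_exp.2 ((le_abs_self _).trans (hN m))
    have h2 := (abs_le.1 (abs_lap_le_CNorm hFper hF m)).1
    exact (mul_le_mul_of_nonneg_left (by linarith) (Real.exp_pos _).le).trans
      (mul_le_mul_of_nonneg_right h1 (by linarith))
  have hx : lap φ x - φ x ≤ lap φ m - φ m := hm x
  nlinarith [(abs_le.1 (hM x)).2, (abs_le.1 (hM m)).1]
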